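/- arXiv:1210.0858 — 3 statements merged into one kernel-verified Lean document; each statement's English description precedes it below -/
import Mathlib

section
/- Fix v = (v1,v2,v3) ∈ ℂ³ and define Φ : (ℂˣ)² → ℂ³ by Φ(λ1,λ2) = (λ1λ2⁻¹·v1, λ1⁻³λ2⁶·v2, λ1⁻³λ2⁻³·v3). Then the image of Φ (the orbit of v under this torus action) is a closed subset of ℂ³ if and only if either v1, v2 and v3 are all nonzero, or v = (0,0,0). -/
/-- A closed set containing `f z` for all nonzero `z`, with `f` continuous, contains `f 0`. -/
theorem IsClosed.apply_zero_mem_of_forall_ne_zero {X : Type*} [TopologicalSpace X] {S : Set X}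
    (hS : IsClosed S) {f : ℂ → X} (hf : Continuous f) (h : ∀ z, z ≠ 0 → f z ∈ S) : f 0 ∈ S := by
  have hsub : ({0}ᶜ : Set ℂ) ⊆ f ⁻¹' S := fun z hz => h z hz
  exact (hS.preimage hf).closure_subset_iff.2 hsub (dense_compl_singleton (0 : ℂ) 0)

/-- The orbit of a vector with nonzero coordinates is a level set of the invariant monomial
`x ^ 9 * y ^ 2 * z`. -/
theorem range_torus_orbit_eq_level_set {v1 v2 v3 : ℂ} (h1 : v1 ≠ 0) (h2 : v2 ≠ 0) (h3 : v3 ≠ 0) :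
    Set.range (fun l : ℂˣ × ℂˣ =>
      (((l.1 : ℂ) * (l.2 : ℂ)⁻¹ * v1,
        (l.1 : ℂ) ^ (-3 : ℤ) * (l.2 : ℂ) ^ (6 : ℤ) * v2,
        (l.1 : ℂ) ^ (-3 : ℤ) * (l.2 : ℂ) ^ (-3 : ℤ) * v3) : ℂ × ℂ × ℂ)) =
    {p | p.1 ^ 9 * p.2.1 ^ 2 * p.2.2 = v1 ^ 9 * v2 ^ 2 * v3} := by
  ext ⟨x, y, z⟩
  simp only [Set.mem_range, Set.mem_ofPred_eq, Prod.mk.injEq]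
  constructor
  · rintro ⟨⟨l, m⟩, rfl, rfl, rfl⟩
    have hl := l.ne_zero
    have hm := m.ne_zero
    simp only [zpow_neg, zpow_ofNat]
    field_simp
  · intro h
    have hc : x ^ 9 * y ^ 2 * z ≠ 0 := by rw [h]; positivity
    have hx : x ≠ 0 := by rintro rfl; simp at hc
    have hy : y ≠ 0 := by rintro rfl; simp at hc
    obtain ⟨m, hm⟩ := IsAlgClosed.exists_pow_nat_eq (y / v2 * (x / v1) ^ 3) (n := 3) (by norm_num)
    have hm0 : m ≠ 0 := by
      rintro rfl
      have : y / v2 * (x / v1) ^ 3 ≠ 0 := by positivity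
      exact this (by rw [← hm]; norm_num)
    refine ⟨(Units.mk0 (x / v1 * m) (by positivity), Units.mk0 m hm0), ?_, ?_, ?_⟩
    · simp only [Units.val_mk0]
      field_simp
    · simp only [Units.val_mk0, zpow_neg, zpow_ofNat]
      rw [mul_pow, show m ^ 6 = (m ^ 3) ^ 2 by ring, hm]
      field_simp
    · simp only [Units.val_mk0, zpow_neg, zpow_ofNat]
      rw [mul_pow, hm]
      field_simp
      linear_combination -h

/-- For `v = (v1, v2, v3) ∈ ℂ³`, the orbit of `v` under the action of the torus `(ℂˣ)²`
acting with weights `(1,-1)`, `(-3,6)`, `(-3,-3)` on the three coordinates, i.e. the image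
of `Φ(λ1,λ2) = (λ1λ2⁻¹·v1, λ1⁻³λ2⁶·v2, λ1⁻³λ2⁻³·v3)`, is closed in `ℂ³` if and only if
`v1`, `v2`, `v3` are all nonzero or `v = (0,0,0)`. -/
theorem stmt_1 (v1 v2 v3 : ℂ) :
    IsClosed (Set.range (fun l : ℂˣ × ℂˣ =>
      (((l.1 : ℂ) * (l.2 : ℂ)⁻¹ * v1,
        (l.1 : ℂ) ^ (-3 : ℤ) * (l.2 : ℂ) ^ (6 : ℤ) * v2,
        (l.1 : ℂ) ^ (-3 : ℤ) * (l.2 : ℂ) ^ (-3 : ℤ) * v3) : ℂ × ℂ × ℂ))) ↔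
    ((v1 ≠ 0 ∧ v2 ≠ 0 ∧ v3 ≠ 0) ∨ (v1 = 0 ∧ v2 = 0 ∧ v3 = 0)) := by
  constructor
  · intro hS
    by_cases h1 : v1 = 0
    · obtain ⟨l, hl⟩ := hS.apply_zero_mem_of_forall_ne_zero
        (f := fun z => (0, z ^ 3 * v2, z ^ 3 * v3)) (by fun_prop)
        (fun z hz => ⟨((Units.mk0 z hz)⁻¹, 1), by
          simp [h1, zpow_ofNat]⟩)
      right
      simpa [Prod.ext_iff, zpow_eq_zero_iff] using hl
    by_cases h2 : v2 = 0
    · obtain ⟨l, hl⟩ := hS.apply_zero_mem_of_forall_ne_zero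
        (f := fun z => (z * v1, 0, z ^ 3 * v3)) (by fun_prop)
        (fun z hz => ⟨(1, (Units.mk0 z hz)⁻¹), by
          simp [h2, zpow_ofNat]⟩)
      right
      simpa [Prod.ext_iff, zpow_eq_zero_iff] using hl
    by_cases h3 : v3 = 0
    · obtain ⟨l, hl⟩ := hS.apply_zero_mem_of_forall_ne_zero
        (f := fun z => (z * v1, z ^ 3 * v2, 0)) (by fun_prop)
        (fun z hz => ⟨(Units.mk0 z hz ^ 3, Units.mk0 z hz ^ 2), by
          simp only [h3, Units.val_pow_eq_pow_val, Units.val_mk0, zpow_neg, zpow_ofNat, mul_zero,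
            Prod.mk.injEq, and_true]
          constructor <;> field_simp⟩)
      right
      simpa [Prod.ext_iff, zpow_eq_zero_iff] using hl
    exact Or.inl ⟨h1, h2, h3⟩
  · rintro (⟨h1, h2, h3⟩ | ⟨rfl, rfl, rfl⟩)
    · rw [range_torus_orbit_eq_level_set h1 h2 h3]
      exact isClosed_eq (by fun_prop) continuous_const
    · simp
end

section
/- Let ζ ∈ ℂ be a primitive 9th root of unity and consider the linear ℤ/9ℤ-action on polynomials in ℂ[z1,z2,z3] induced by the substitution (z1,z2,z3) ↦ (z1, ζz2, ζ⁻¹z3). The complex vector space of homogeneous polynomials of degree 6 invariant under this action is spanned by z1⁶, z1⁴z2z3, z1²z2²z3² and z2³z3³. Consequently, every invariant homogeneous polynomial of degree 6 vanishes at the points (0,1,0) and (0,0,1) of ℂ³. -/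
open MvPolynomial

/-- Rescaling each variable `X i` by `c i` multiplies the coefficient of the monomial with
exponent `m` by `∏ i, c i ^ m i`. -/
theorem coeff_aeval_C_mul_X {σ R : Type*} [Fintype σ] [CommSemiring R] (c : σ → R)
    (f : MvPolynomial σ R) (m : σ →₀ ℕ) :
    coeff m (aeval (fun i => C (c i) * X i : σ → MvPolynomial σ R) f) =
      (∏ i, c i ^ m i) * coeff m f := by
  classical
  induction f using MvPolynomial.induction_on' with
  | add p q hp hq => rw [map_add, coeff_add, coeff_add, hp, hq, mul_add]
  | monomial d a =>
    have h : aeval (fun i => C (c i) * X i : σ → MvPolynomial σ R) (monomial d a) =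
        C (∏ i, c i ^ d i) * monomial d a := by
      rw [aeval_monomial, Finsupp.prod_fintype _ _ (by simp), monomial_eq,
        Finsupp.prod_fintype _ _ (by simp)]
      simp only [mul_pow, Finset.prod_mul_distrib, algebraMap_eq, map_prod, map_pow]
      ring
    rw [h, coeff_C_mul, coeff_monomial]
    split_ifs with hd
    · rw [hd]
    · simp

/-- A monomial occurring in an invariant homogeneous sextic has equal exponents in the second
and third variables. -/
theorem exponent_eq_of_invariant {ζ : ℂ} (hζ : IsPrimitiveRoot ζ 9)
    {f : MvPolynomial (Fin 3) ℂ} (hf : f.IsHomogeneous 6)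
    (hinv : aeval ![(X 0 : MvPolynomial (Fin 3) ℂ), C ζ * X 1, C ζ⁻¹ * X 2] f = f)
    {m : Fin 3 →₀ ℕ} (hm : coeff m f ≠ 0) :
    m 0 + m 1 + m 2 = 6 ∧ m 1 = m 2 := by
  have hdeg : m 0 + m 1 + m 2 = 6 := by
    have h := hf hm
    rwa [Finsupp.weight_apply, Finsupp.sum_fintype _ _ (by simp), Fin.sum_univ_three,
      Pi.one_apply, Pi.one_apply, Pi.one_apply, smul_eq_mul, smul_eq_mul, smul_eq_mul,
      mul_one, mul_one, mul_one] at h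
  refine ⟨hdeg, hζ.pow_inj (by omega) (by omega) ?_⟩
  have hsubst : ![(X 0 : MvPolynomial (Fin 3) ℂ), C ζ * X 1, C ζ⁻¹ * X 2] =
      fun i => C (![1, ζ, ζ⁻¹] i) * X i := by
    ext1 i
    fin_cases i <;> simp
  have h := coeff_aeval_C_mul_X ![1, ζ, ζ⁻¹] f m
  rw [← hsubst, hinv, eq_comm, mul_eq_right₀ hm, Fin.prod_univ_three] at h
  have h0 : ζ ^ m 2 ≠ 0 := pow_ne_zero _ (hζ.ne_zero (by norm_num))
  simpa [← div_eq_mul_inv, div_eq_one_iff_eq h0] using h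

/-- Every invariant homogeneous sextic is a linear combination of the four invariant monomials. -/
theorem mem_span_of_invariant {ζ : ℂ} (hζ : IsPrimitiveRoot ζ 9)
    {f : MvPolynomial (Fin 3) ℂ} (hf : f.IsHomogeneous 6)
    (hinv : aeval ![(X 0 : MvPolynomial (Fin 3) ℂ), C ζ * X 1, C ζ⁻¹ * X 2] f = f) :
    f ∈ Submodule.span ℂ
      {(X 0 : MvPolynomial (Fin 3) ℂ) ^ 6, X 0 ^ 4 * X 1 * X 2,
        X 0 ^ 2 * X 1 ^ 2 * X 2 ^ 2, X 1 ^ 3 * X 2 ^ 3} := by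
  rw [f.as_sum]
  refine Submodule.sum_mem _ fun m hm => ?_
  obtain ⟨hdeg, heq⟩ := exponent_eq_of_invariant hζ hf hinv (mem_support_iff.mp hm)
  rw [monomial_eq, Finsupp.prod_fintype _ _ (by simp), Fin.prod_univ_three, ← smul_eq_C_mul]
  refine Submodule.smul_mem _ _ (Submodule.subset_span ?_)
  have h0 : m 0 = 6 - 2 * m 2 := by omega
  have h2 : m 2 ≤ 3 := by omega
  rw [h0, heq]
  interval_cases m 2 <;> simp

/-- Let `ζ` be a primitive 9th root of unity and consider the `ℤ/9ℤ`-action on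
`ℂ[z1,z2,z3]` induced by `(z1,z2,z3) ↦ (z1, ζz2, ζ⁻¹z3)`.  The space of invariant
homogeneous sextics is spanned by `z1⁶`, `z1⁴z2z3`, `z1²z2²z3²`, `z2³z3³`;
consequently every invariant homogeneous sextic vanishes at `(0,1,0)` and `(0,0,1)`. -/
theorem stmt_4 (ζ : ℂ) (hζ : IsPrimitiveRoot ζ 9) :
    ({f : MvPolynomial (Fin 3) ℂ | f.IsHomogeneous 6 ∧
        aeval ![(X 0 : MvPolynomial (Fin 3) ℂ), C ζ * X 1, C ζ⁻¹ * X 2] f = f}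
      = ↑(Submodule.span ℂ
          {(X 0 : MvPolynomial (Fin 3) ℂ) ^ 6, X 0 ^ 4 * X 1 * X 2,
            X 0 ^ 2 * X 1 ^ 2 * X 2 ^ 2, X 1 ^ 3 * X 2 ^ 3})) ∧
    ∀ f : MvPolynomial (Fin 3) ℂ, f.IsHomogeneous 6 →
      aeval ![(X 0 : MvPolynomial (Fin 3) ℂ), C ζ * X 1, C ζ⁻¹ * X 2] f = f →
      eval ![(0 : ℂ), 1, 0] f = 0 ∧ eval ![(0 : ℂ), 0, 1] f = 0 := by
  refine ⟨Set.Subset.antisymm (fun f hf => mem_span_of_invariant hζ hf.1 hf.2) ?_,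
    fun f hf hinv => ?_⟩
  · intro f hf
    have hCC : (C ζ * C ζ⁻¹ : MvPolynomial (Fin 3) ℂ) = 1 := by
      rw [← C_mul, mul_inv_cancel₀ (hζ.ne_zero (by norm_num)), C_1]
    induction hf using Submodule.span_induction with
    | zero => exact ⟨isHomogeneous_zero _ _ _, map_zero _⟩
    | add p q _ _ hp hq => exact ⟨hp.1.add hq.1, by rw [map_add, hp.2, hq.2]⟩
    | smul a p _ hp =>
      exact ⟨(homogeneousSubmodule (Fin 3) ℂ 6).smul_mem a hp.1, by rw [map_smul, hp.2]⟩
    | mem p hp =>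
      have hX (i : Fin 3) (n : ℕ) : (X i ^ n : MvPolynomial (Fin 3) ℂ).IsHomogeneous n :=
        isHomogeneous_X_pow i n
      rcases hp with rfl | rfl | rfl | rfl
      · exact ⟨hX 0 6, by simp⟩
      · refine ⟨((hX 0 4).mul (isHomogeneous_X ℂ 1)).mul (isHomogeneous_X ℂ 2), ?_⟩
        simp only [map_mul, map_pow, aeval_X, Matrix.cons_val]
        linear_combination (X 0 ^ 4 * X 1 * X 2) * hCC
      · refine ⟨((hX 0 2).mul (hX 1 2)).mul (hX 2 2), ?_⟩
        simp only [map_mul, map_pow, aeval_X, Matrix.cons_val]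
        linear_combination (X 0 ^ 2 * X 1 ^ 2 * X 2 ^ 2) * (C ζ * C ζ⁻¹ + 1) * hCC
      · refine ⟨(hX 1 3).mul (hX 2 3), ?_⟩
        simp only [map_mul, map_pow, aeval_X, Matrix.cons_val]
        linear_combination
          (X 1 ^ 3 * X 2 ^ 3) * ((C ζ * C ζ⁻¹) ^ 2 + C ζ * C ζ⁻¹ + 1) * hCC
  · have hspan := mem_span_of_invariant hζ hf hinv
    clear hf hinv
    induction hspan using Submodule.span_induction with
    | zero => simp
    | add p q _ _ hp hq => simp [hp, hq]
    | smul a p _ hp => simp [smul_eval, hp]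
    | mem p hp => rcases hp with rfl | rfl | rfl | rfl <;> simp
end

section
/- Let ω ∈ ℂ be a primitive cube root of unity and define ψ : ℙ²(ℂ) → ℙ³(ℂ) by ψ([z1:z2:z3]) = [z1z2z3 : z1³ : z2³ : z3³]. Then: (i) the image of ψ is exactly the cubic surface {[x0:x1:x2:x3] ∈ ℙ³ : x1x2x3 = x0³}; and (ii) ψ([z]) = ψ([z']) if and only if [z'] = [z1 : ωᵏz2 : ω⁻ᵏz3] for some integer k. Hence ψ induces a bijection from the quotient of ℙ² by the ℤ/3ℤ-action generated by [z1:z2:z3] ↦ [z1 : ωz2 : ω⁻¹z3] onto the cubic {x1x2x3 = x0³}. -/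
open Projectivization

/-- The homogeneous map `ℂ³ → ℂ⁴`, `(z1,z2,z3) ↦ (z1z2z3, z1³, z2³, z3³)`. -/
noncomputable def cubicVec (v : Fin 3 → ℂ) : Fin 4 → ℂ :=
  ![v 0 * v 1 * v 2, v 0 ^ 3, v 1 ^ 3, v 2 ^ 3]

theorem cubicVec_ne_zero {v : Fin 3 → ℂ} (hv : v ≠ 0) : cubicVec v ≠ 0 := by
  intro h
  apply hv
  have h1 : v 0 ^ 3 = 0 := by simpa [cubicVec] using congrFun h 1
  have h2 : v 1 ^ 3 = 0 := by simpa [cubicVec] using congrFun h 2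
  have h3 : v 2 ^ 3 = 0 := by simpa [cubicVec] using congrFun h 3
  rw [pow_eq_zero_iff (by norm_num)] at h1 h2 h3
  funext i
  fin_cases i <;> simpa

/-- The induced map `ψ : ℙ²(ℂ) → ℙ³(ℂ)`, `[z1:z2:z3] ↦ [z1z2z3 : z1³ : z2³ : z3³]`. -/
noncomputable def psiMap (p : Projectivization ℂ (Fin 3 → ℂ)) :
    Projectivization ℂ (Fin 4 → ℂ) :=
  Projectivization.mk ℂ (cubicVec p.rep) (cubicVec_ne_zero p.rep_nonzero)

theorem cubicVec_smul (c : ℂ) (v : Fin 3 → ℂ) : cubicVec (c • v) = c ^ 3 • cubicVec v := by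
  funext i
  fin_cases i <;> simp [cubicVec] <;> ring

theorem psiMap_mk (v : Fin 3 → ℂ) (hv : v ≠ 0) :
    psiMap (Projectivization.mk ℂ v hv) =
      Projectivization.mk ℂ (cubicVec v) (cubicVec_ne_zero hv) := by
  obtain ⟨a, ha⟩ := Projectivization.exists_smul_eq_mk_rep ℂ v hv
  rw [psiMap, Projectivization.mk_eq_mk_iff']
  refine ⟨(a : ℂ) ^ 3, ?_⟩
  rw [← cubicVec_smul, ← ha]
  rfl

theorem exists_cube_eq_one_of_cube_eq {K : Type*} [Field K] {a b : K} (h : a ^ 3 = b ^ 3) :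
    ∃ ζ : K, ζ ^ 3 = 1 ∧ a = ζ * b := by
  by_cases hb : b = 0
  · refine ⟨1, one_pow 3, ?_⟩
    simpa [hb] using h
  · refine ⟨a / b, ?_, (div_mul_cancel₀ a hb).symm⟩
    rw [div_pow, h, div_self (pow_ne_zero 3 hb)]

theorem exists_cubicVec_eq {x : Fin 4 → ℂ} (hx : x 1 * x 2 * x 3 = x 0 ^ 3) :
    ∃ z : Fin 3 → ℂ, cubicVec z = x := by
  obtain ⟨a, ha⟩ := IsAlgClosed.exists_pow_nat_eq (x 1) (n := 3) (by norm_num)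
  obtain ⟨b, hb⟩ := IsAlgClosed.exists_pow_nat_eq (x 2) (n := 3) (by norm_num)
  obtain ⟨c, hc⟩ := IsAlgClosed.exists_pow_nat_eq (x 3) (n := 3) (by norm_num)
  obtain ⟨ζ, hζ, h⟩ : ∃ ζ : ℂ, ζ ^ 3 = 1 ∧ x 0 = ζ * (a * b * c) := by
    apply exists_cube_eq_one_of_cube_eq
    rw [← hx, ← ha, ← hb, ← hc]
    ring
  refine ⟨![ζ * a, b, c], ?_⟩
  funext i
  fin_cases i
  · simp [cubicVec, h]
    ring
  · simp [cubicVec, mul_pow, hζ, ha]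
  · simp [cubicVec, hb]
  · simp [cubicVec, hc]

/-- Vectors with the same image under `cubicVec` differ by a diagonal matrix of determinant one
whose entries are cube roots of unity. -/
theorem exists_diagonal_of_cubicVec_eq {v w : Fin 3 → ℂ} (h : cubicVec w = cubicVec v) :
    ∃ ζ : Fin 3 → ℂ, (∀ i, ζ i ^ 3 = 1) ∧ ζ 0 * ζ 1 * ζ 2 = 1 ∧ ∀ i, w i = ζ i * v i := by
  have h0 : w 0 * w 1 * w 2 = v 0 * v 1 * v 2 := by simpa [cubicVec] using congrFun h 0
  have h1 : w 0 ^ 3 = v 0 ^ 3 := by simpa [cubicVec] using congrFun h 1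
  have h2 : w 1 ^ 3 = v 1 ^ 3 := by simpa [cubicVec] using congrFun h 2
  have h3 : w 2 ^ 3 = v 2 ^ 3 := by simpa [cubicVec] using congrFun h 3
  obtain ⟨a, ha, ea⟩ := exists_cube_eq_one_of_cube_eq h1
  obtain ⟨b, hb, eb⟩ := exists_cube_eq_one_of_cube_eq h2
  obtain ⟨c, hc, ec⟩ := exists_cube_eq_one_of_cube_eq h3
  have ne_zero {x : ℂ} (hx : x ^ 3 = 1) : x ≠ 0 := by
    rintro rfl
    norm_num at hx
  have ha0 := ne_zero ha
  have hb0 := ne_zero hb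
  have hc0 := ne_zero hc
  by_cases v0 : v 0 = 0
  · refine ⟨![(b * c)⁻¹, b, c], ?_, ?_, ?_⟩
    · simp [Fin.forall_fin_succ, mul_pow, hb, hc]
    · simp
      field_simp
    · simp [Fin.forall_fin_succ, ea, eb, ec, v0]
  by_cases v1 : v 1 = 0
  · refine ⟨![a, (a * c)⁻¹, c], ?_, ?_, ?_⟩
    · simp [Fin.forall_fin_succ, mul_pow, ha, hc]
    · simp
      field_simp
    · simp [Fin.forall_fin_succ, ea, eb, ec, v1]
  by_cases v2 : v 2 = 0
  · refine ⟨![a, b, (a * b)⁻¹], ?_, ?_, ?_⟩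
    · simp [Fin.forall_fin_succ, mul_pow, ha, hb]
    · simp
      field_simp
    · simp [Fin.forall_fin_succ, ea, eb, ec, v2]
  refine ⟨![a, b, c], ?_, ?_, ?_⟩
  · simp [Fin.forall_fin_succ, ha, hb, hc]
  · have hv : v 0 * v 1 * v 2 ≠ 0 := by simp [v0, v1, v2]
    apply mul_right_cancel₀ hv
    rw [ea, eb, ec] at h0
    simp only [Matrix.cons_val]
    linear_combination h0
  · simp [Fin.forall_fin_succ, ea, eb, ec]

theorem range_psiMap :
    Set.range psiMap = {q : Projectivization ℂ (Fin 4 → ℂ) |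
        q.rep 1 * q.rep 2 * q.rep 3 = q.rep 0 ^ 3} := by
  ext q
  constructor
  · rintro ⟨p, rfl⟩
    obtain ⟨a, ha⟩ := Projectivization.exists_smul_eq_mk_rep ℂ (cubicVec p.rep)
      (cubicVec_ne_zero p.rep_nonzero)
    rw [Set.mem_ofPred_eq, psiMap, ← ha]
    simp [cubicVec, Units.smul_def]
    ring
  · intro hq
    obtain ⟨z, hz⟩ := exists_cubicVec_eq hq
    have hz0 : z ≠ 0 := by
      rintro rfl
      apply q.rep_nonzero
      rw [← hz]
      funext i
      fin_cases i <;> simp [cubicVec]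
    refine ⟨Projectivization.mk ℂ z hz0, ?_⟩
    rw [psiMap_mk]
    simp only [hz, Projectivization.mk_rep]

theorem cubicVec_diagonal {ω : ℂ} (hω : ω ^ 3 = 1) (k : ℤ) (v : Fin 3 → ℂ) :
    cubicVec ![v 0, ω ^ k * v 1, ω ^ (-k) * v 2] = cubicVec v := by
  have hω0 : ω ≠ 0 := by
    rintro rfl
    norm_num at hω
  have hk : (ω ^ k) ^ 3 = 1 := by
    rw [← zpow_natCast, ← zpow_mul, mul_comm, zpow_mul, zpow_natCast, hω, one_zpow]
  have hk0 : ω ^ k ≠ 0 := zpow_ne_zero k hω0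
  funext i
  fin_cases i
  · simp [cubicVec]
    field_simp
  · simp [cubicVec]
  · simp [cubicVec, mul_pow, hk]
  · simp [cubicVec, mul_pow, hk]

/-- Let `ω` be a primitive cube root of unity and `ψ : ℙ² → ℙ³`,
`ψ([z1:z2:z3]) = [z1z2z3 : z1³ : z2³ : z3³]`.  Then (i) the image of `ψ` is exactly
the cubic surface `{x1x2x3 = x0³}`, and (ii) `ψ([z]) = ψ([z'])` iff
`[z'] = [z1 : ωᵏz2 : ω⁻ᵏz3]` for some integer `k`. -/
theorem stmt_14 (ω : ℂ) (hω : IsPrimitiveRoot ω 3) :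
    (Set.range psiMap = {q : Projectivization ℂ (Fin 4 → ℂ) |
        q.rep 1 * q.rep 2 * q.rep 3 = q.rep 0 ^ 3}) ∧
    ∀ (v v' : Fin 3 → ℂ) (hv : v ≠ 0) (hv' : v' ≠ 0),
      psiMap (Projectivization.mk ℂ v hv) = psiMap (Projectivization.mk ℂ v' hv') ↔
        ∃ (k : ℤ) (h : (![v 0, ω ^ k * v 1, ω ^ (-k) * v 2] : Fin 3 → ℂ) ≠ 0),
          Projectivization.mk ℂ v' hv'
            = Projectivization.mk ℂ (![v 0, ω ^ k * v 1, ω ^ (-k) * v 2]) h := by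
  refine ⟨range_psiMap, fun v v' hv hv' => ⟨fun h => ?_, ?_⟩⟩
  · rw [psiMap_mk, psiMap_mk, Projectivization.mk_eq_mk_iff'] at h
    obtain ⟨a, ha⟩ := h
    obtain ⟨c, rfl⟩ := IsAlgClosed.exists_pow_nat_eq a (n := 3) (by norm_num)
    have hc : c ≠ 0 := by
      rintro rfl
      apply cubicVec_ne_zero hv
      simp [← ha]
    rw [← cubicVec_smul] at ha
    obtain ⟨ζ, hζ, hprod, hw⟩ := exists_diagonal_of_cubicVec_eq ha
    have hζ0 (i) : ζ i ≠ 0 := by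
      intro h0
      simpa [h0] using hζ i
    obtain ⟨n, -, hn⟩ := hω.eq_pow_of_pow_eq_one (ξ := ζ 1 / ζ 0) (by simp [div_pow, hζ])
    have hn' : (ω ^ n)⁻¹ = ζ 2 / ζ 0 := by
      have h00 := hζ0 0
      have h01 := hζ0 1
      rw [hn, inv_div, div_eq_div_iff h01 h00]
      apply mul_left_cancel₀ h00
      linear_combination hζ 0 - hprod
    have key : c • v' = ζ 0 • ![v 0, ω ^ (n : ℤ) * v 1, ω ^ (-(n : ℤ)) * v 2] := by
      have h00 := hζ0 0
      funext i
      rw [hw i, zpow_neg, zpow_natCast, hn', hn]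
      fin_cases i
      · simp
      · simp
        field_simp
      · simp
        field_simp
    have hne : ![v 0, ω ^ (n : ℤ) * v 1, ω ^ (-(n : ℤ)) * v 2] ≠ 0 := by
      intro h0
      rw [h0, smul_zero] at key
      exact smul_ne_zero hc hv' key
    refine ⟨n, hne, ?_⟩
    rw [Projectivization.mk_eq_mk_iff']
    refine ⟨c⁻¹ * ζ 0, ?_⟩
    rw [mul_smul, ← key, inv_smul_smul₀ hc]
  · rintro ⟨k, h, e⟩
    rw [e, psiMap_mk, psiMap_mk]
    simp only [cubicVec_diagonal hω.pow_eq_one]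
end
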